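/- Let 0 < p < 1/2. There exists a constant c_p > 0, depending only on p (and on sup_n m_n), such that for every martingale f ∈ H_p(G_m) and every n ∈ ℕ, ‖σ_{M_n} f‖_{L_p(μ)} ≤ c_p ‖f‖_{H_p}. -/

import Mathlib

open MeasureTheory Filter
open scoped ENNReal NNReal Real BigOperators

noncomputable section

namespace Vilenkin

instance (k : ℕ) : MeasurableSpace (ZMod k) := ⊤

/-- The Vilenkin group: the product of the cyclic groups `ZMod (m n)`. -/
abbrev G (m : ℕ → ℕ) : Type := ∀ n : ℕ, ZMod (m n)

variable (m : ℕ → ℕ)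

/-- The generalized powers `M_0 = 1`, `M_{n+1} = m_n M_n`. -/
def Mprod : ℕ → ℕ
  | 0 => 1
  | n + 1 => m n * Mprod n

/-- The `k`-th digit of `n` in the base-`M` expansion `n = Σ_k n_k M_k`. -/
def digit (n k : ℕ) : ℕ := (n / Mprod m k) % m k

/-- `⟨n⟩`, the smallest index of a nonzero digit. -/
def lowIdx (n : ℕ) : ℕ := sInf {j | digit m n j ≠ 0}

/-- `|n|`, the largest index of a nonzero digit. -/
def highIdx (n : ℕ) : ℕ := sSup {j | digit m n j ≠ 0}

/-- Generalized Rademacher functions `r_k(x) = exp(2πi x_k / m_k)`. -/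
def rad (k : ℕ) (x : G m) : ℂ :=
  Complex.exp (2 * Real.pi * Complex.I * ((x k).val : ℂ) / (m k : ℂ))

/-- The Vilenkin system `ψ_n = ∏_k r_k^{n_k}`. -/
def psi (n : ℕ) (x : G m) : ℂ :=
  ∏ k ∈ Finset.range (n + 1), rad m k x ^ digit m n k

/-- Dirichlet kernels `D_n = Σ_{k<n} ψ_k`. -/
def Dker (n : ℕ) (x : G m) : ℂ := ∑ k ∈ Finset.range n, psi m k x

/-- Fejér kernels `K_n = (1/n) Σ_{k<n} D_k`. -/
def Kker (n : ℕ) (x : G m) : ℂ := (n : ℂ)⁻¹ * ∑ k ∈ Finset.range n, Dker m k x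

/-- The cylinder `I_n(x)`. -/
def cylinder (n : ℕ) (x : G m) : Set (G m) := {y | ∀ j, j < n → y j = x j}

/-- `e_t`: the element with `t`-th coordinate `1` and all others `0`. -/
def eVec (t : ℕ) : G m := fun j => if j = t then 1 else 0

/-- The filtration `F_n` generated by the cylinders of level `n`. -/
def filtr (n : ℕ) : MeasurableSpace (G m) :=
  MeasurableSpace.comap (fun x (j : Fin n) => x j.val) inferInstance

/-- The normalized Haar measure on `G_m`: the probability measure giving each cylinder
`I_n(x)` measure `1/M_n`. -/
def IsVilenkinMeasure (μ : Measure (G m)) : Prop :=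
  IsProbabilityMeasure μ ∧ ∀ n x, μ (cylinder m n x) = (Mprod m n : ℝ≥0∞)⁻¹

/-- Martingales with respect to the filtration `(F_n)`. -/
def IsMartingale (μ : Measure (G m)) (f : ℕ → G m → ℂ) : Prop :=
  (∀ n, Integrable (f n) μ) ∧
  (∀ n, Measurable[filtr m n] (f n)) ∧
  (∀ n, ∀ s : Set (G m), MeasurableSet[filtr m n] s →
    ∫ x in s, f (n + 1) x ∂μ = ∫ x in s, f n x ∂μ)

/-- The maximal function `f* = sup_n |f^{(n)}|` (with values in `ℝ≥0∞`). -/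
def maximalFn (f : ℕ → G m → ℂ) (x : G m) : ℝ≥0∞ := ⨆ n, (‖f n x‖₊ : ℝ≥0∞)

/-- The martingale Hardy space quasi-norm `‖f‖_{H_p} = ‖f*‖_{L_p}`. -/
def hardyNorm (p : ℝ) (μ : Measure (G m)) (f : ℕ → G m → ℂ) : ℝ≥0∞ :=
  (∫⁻ x, maximalFn m f x ^ p ∂μ) ^ (1 / p)

/-- Vilenkin-Fourier coefficients of an integrable function. -/
def fourierCoeff (μ : Measure (G m)) (g : G m → ℂ) (k : ℕ) : ℂ :=
  ∫ x, g x * (starRingEnd ℂ) (psi m k x) ∂μ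

/-- Partial sums `S_n g` of the Vilenkin-Fourier series of a function. -/
def SFun (μ : Measure (G m)) (g : G m → ℂ) (n : ℕ) (x : G m) : ℂ :=
  ∑ k ∈ Finset.range n, fourierCoeff m μ g k * psi m k x

/-- Fejér means `σ_n g` of a function. -/
def sigmaFun (μ : Measure (G m)) (g : G m → ℂ) (n : ℕ) (x : G m) : ℂ :=
  (n : ℂ)⁻¹ * ∑ k ∈ Finset.range n, SFun m μ g k x

/-- Vilenkin-Fourier coefficients of a martingale:
`f̂(i) = lim_k ∫ f^{(k)} ψ̄_i dμ`. -/
def martCoeff (μ : Measure (G m)) (f : ℕ → G m → ℂ) (i : ℕ) : ℂ :=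
  limUnder atTop fun k => ∫ x, f k x * (starRingEnd ℂ) (psi m i x) ∂μ

/-- Partial sums `S_n f` of the Vilenkin-Fourier series of a martingale. -/
def SMart (μ : Measure (G m)) (f : ℕ → G m → ℂ) (n : ℕ) (x : G m) : ℂ :=
  ∑ k ∈ Finset.range n, martCoeff m μ f k * psi m k x

/-- Fejér means `σ_n f` of a martingale. -/
def sigmaMart (μ : Measure (G m)) (f : ℕ → G m → ℂ) (n : ℕ) (x : G m) : ℂ :=
  (n : ℂ)⁻¹ * ∑ k ∈ Finset.range n, SMart m μ f k x

/-- The weak `L_p` quasi-norm `‖g‖_{L_{p,∞}} = (sup_λ λ^p μ(|g|>λ))^{1/p}`. -/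
def weakNorm (p : ℝ) (μ : Measure (G m)) (g : G m → ℂ) : ℝ≥0∞ :=
  (⨆ lam : ℝ≥0, (lam : ℝ≥0∞) ^ p * μ {x | (lam : ℝ) < ‖g x‖}) ^ (1 / p)

/-- A `p`-atom with prescribed support interval `I_N(x₀)`. -/
def IsPAtomAt (p : ℝ) (μ : Measure (G m)) (N : ℕ) (x₀ : G m) (a : G m → ℂ) : Prop :=
  Measurable a ∧ Function.support a ⊆ cylinder m N x₀ ∧
    (∫ x in cylinder m N x₀, a x ∂μ) = 0 ∧
    eLpNorm a ⊤ μ ≤ μ (cylinder m N x₀) ^ (-(1 / p))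

/-- A `p`-atom. -/
def IsPAtom (p : ℝ) (μ : Measure (G m)) (a : G m → ℂ) : Prop :=
  ∃ N x₀, IsPAtomAt m p μ N x₀ a

/-- The sets `I_N^{i,j}` for `i < j ≤ N`. -/
def IsetIJ (N i j : ℕ) : Set (G m) :=
  if j < N then
    {x | (∀ l, l < i → x l = 0) ∧ x i ≠ 0 ∧ (∀ l, i < l → l < j → x l = 0) ∧ x j ≠ 0}
  else
    {x | (∀ l, l < i → x l = 0) ∧ x i ≠ 0 ∧ (∀ l, i < l → l < N → x l = 0)}

section Auxiliary

variable {m}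

theorem Mprod_pos (hm : ∀ n, 2 ≤ m n) (n : ℕ) : 0 < Mprod m n := by
  induction n with
  | zero => simp [Mprod]
  | succ n ih => exact Nat.mul_pos (by linarith [hm n]) ih

theorem lt_Mprod (hm : ∀ n, 2 ≤ m n) (n : ℕ) : n < Mprod m n := by
  induction n with
  | zero => simp [Mprod]
  | succ n ih =>
    have : 2 * Mprod m n ≤ m n * Mprod m n := Nat.mul_le_mul_right _ (hm n)
    simp only [Mprod]
    omega

theorem Mprod_dvd {a b : ℕ} (h : a ≤ b) : Mprod m a ∣ Mprod m b := by
  induction b, h using Nat.le_induction with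
  | base => rfl
  | succ b _ ih => exact ih.mul_left _

theorem two_pow_mul_Mprod_le (hm : ∀ n, 2 ≤ m n) (t d : ℕ) :
    2 ^ d * Mprod m t ≤ Mprod m (t + d) := by
  induction d with
  | zero => simp
  | succ d ih =>
    calc 2 ^ (d + 1) * Mprod m t = 2 * (2 ^ d * Mprod m t) := by ring
      _ ≤ m (t + d) * Mprod m (t + d) := Nat.mul_le_mul (hm _) ih

theorem digit_eq_zero (hm : ∀ n, 2 ≤ m n) {k n j : ℕ} (hk : k < Mprod m n) (hj : n ≤ j) :
    digit m k j = 0 := by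
  have : k < Mprod m j := hk.trans_le (Nat.le_of_dvd (Mprod_pos hm j) (Mprod_dvd hj))
  simp [digit, Nat.div_eq_of_lt this]

theorem digit_add_mul (hm : ∀ n, 2 ≤ m n) (a b : ℕ) {n j : ℕ} (hj : j < n) :
    digit m (a + b * Mprod m n) j = digit m a j := by
  obtain ⟨c, hc⟩ : Mprod m (j + 1) ∣ Mprod m n := Mprod_dvd hj
  have : a + b * Mprod m n = a + Mprod m j * (m j * (b * c)) := by
    rw [hc]; simp only [Mprod]; ring
  rw [digit, this, Nat.add_mul_div_left _ _ (Mprod_pos hm j), Nat.add_mul_mod_self_left, digit]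

theorem digit_add_mul_self {a b n : ℕ} (ha : a < Mprod m n) (hb : b < m n) :
    digit m (a + b * Mprod m n) n = b := by
  rw [digit, Nat.add_mul_div_right _ _ (by omega), Nat.div_eq_of_lt ha, zero_add,
    Nat.mod_eq_of_lt hb]

/-- The expansion of `k` in the generalized number system, truncated at level `n`. -/
theorem mod_Mprod_eq_sum (k n : ℕ) :
    k % Mprod m n = ∑ t ∈ Finset.range n, Mprod m t * digit m k t := by
  induction n with
  | zero => simp [Mprod, Nat.mod_one]
  | succ n ih =>
    rw [Finset.sum_range_succ, ← ih, Mprod, mul_comm (m n), Nat.mod_mul, digit]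

theorem sum_range_mul_eq {A : Type*} [AddCommMonoid A] (g : ℕ → A) (b M : ℕ) :
    ∑ k ∈ Finset.range (b * M), g k
      = ∑ i ∈ Finset.range b, ∑ a ∈ Finset.range M, g (a + i * M) := by
  induction b with
  | zero => simp
  | succ b ih =>
    rw [Nat.succ_mul, Finset.sum_range_add, ih, Finset.sum_range_succ]
    simp only [add_comm]

/-- The sum of the partial sums of a sequence, in terms of the weighted sum. -/
theorem sum_sum_range (a : ℕ → ℂ) (N : ℕ) :
    ∑ k ∈ Finset.range N, ∑ j ∈ Finset.range k, a j
      = ((N : ℂ) - 1) * ∑ k ∈ Finset.range N, a k - ∑ k ∈ Finset.range N, (k : ℂ) * a k := by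
  induction N with
  | zero => simp
  | succ N ih =>
    rw [Finset.sum_range_succ, ih, Finset.sum_range_succ a,
      Finset.sum_range_succ (fun k => (k : ℂ) * a k)]
    push_cast
    ring

variable (m) in
/-- The primitive root of unity `exp (2πi / m_k)`. -/
def zeta (k : ℕ) : ℂ := Complex.exp (2 * Real.pi * Complex.I / (m k : ℂ))

theorem zeta_primitive (hm : ∀ n, 2 ≤ m n) (k : ℕ) : IsPrimitiveRoot (zeta m k) (m k) :=
  Complex.isPrimitiveRoot_exp _ (by have := hm k; omega)

theorem norm_zeta (hm : ∀ n, 2 ≤ m n) (k : ℕ) : ‖zeta m k‖ = 1 :=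
  (zeta_primitive hm k).norm'_eq_one (by have := hm k; omega)

theorem rad_eq (k : ℕ) (x : G m) : rad m k x = zeta m k ^ (x k).val := by
  rw [rad, zeta, ← Complex.exp_nat_mul]
  congr 1
  ring

theorem mul_conj_pow_zeta (hm : ∀ n, 2 ≤ m n) (k i : ℕ) :
    zeta m k ^ i * (starRingEnd ℂ) (zeta m k ^ i) = 1 := by
  rw [Complex.mul_conj, Complex.normSq_eq_norm_sq, norm_pow, norm_zeta hm]
  simp

/-- Orthogonality relation for the roots of unity. -/
theorem sum_zeta_pow (hm : ∀ n, 2 ≤ m n) (k : ℕ) {i j : ℕ} (hi : i < m k) (hj : j < m k) :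
    ∑ s ∈ Finset.range (m k), (zeta m k ^ i * (starRingEnd ℂ) (zeta m k ^ j)) ^ s
      = if i = j then (m k : ℂ) else 0 := by
  set z := zeta m k ^ i * (starRingEnd ℂ) (zeta m k ^ j) with hz
  split_ifs with h
  · have : z = 1 := by rw [hz, h, mul_conj_pow_zeta hm]
    simp [this]
  · have hz1 : z ≠ 1 := by
      intro h1
      apply h
      apply (zeta_primitive hm k).pow_inj hi hj
      calc zeta m k ^ i = zeta m k ^ i * (zeta m k ^ j * (starRingEnd ℂ) (zeta m k ^ j)) := by
            rw [mul_conj_pow_zeta hm, mul_one]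
        _ = z * zeta m k ^ j := by rw [hz]; ring
        _ = zeta m k ^ j := by rw [h1, one_mul]
    have hzm : z ^ m k = 1 := by
      have h1 := (zeta_primitive hm k).pow_eq_one
      rw [hz, mul_pow, ← map_pow, ← pow_mul, ← pow_mul, mul_comm i, mul_comm j, pow_mul, pow_mul, h1]
      simp
    have := geom_sum_mul z (m k)
    rw [hzm, sub_self] at this
    exact (mul_eq_zero.1 this).resolve_right (sub_ne_zero.2 hz1)

variable (m) in
/-- The Vilenkin function `ψ_k` truncated to its first `n` factors. -/
def psiTrunc (n k : ℕ) (x : G m) : ℂ := ∏ j ∈ Finset.range n, rad m j x ^ digit m k j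

theorem psiTrunc_eq_of_le (hm : ∀ n, 2 ≤ m n) {a b k : ℕ} (hk : k < Mprod m a) (hab : a ≤ b)
    (x : G m) : psiTrunc m a k x = psiTrunc m b k x := by
  apply Finset.prod_subset (Finset.range_mono hab)
  intro j _ hj
  rw [digit_eq_zero hm hk (by simpa using hj), pow_zero]

theorem psi_eq_psiTrunc (hm : ∀ n, 2 ≤ m n) {n k : ℕ} (hk : k < Mprod m n) (x : G m) :
    psi m k x = psiTrunc m n k x := by
  have h1 : k < Mprod m (k + 1) := (Nat.lt_succ_self k).trans (lt_Mprod hm _)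
  exact (psiTrunc_eq_of_le hm h1 (le_max_left _ n) x).trans
    (psiTrunc_eq_of_le hm hk (le_max_right _ _) x).symm

theorem psiTrunc_add_mul (hm : ∀ n, 2 ≤ m n) {a b n : ℕ} (ha : a < Mprod m n) (hb : b < m n)
    (x : G m) :
    psiTrunc m (n + 1) (a + b * Mprod m n) x = psiTrunc m n a x * rad m n x ^ b := by
  rw [psiTrunc, Finset.prod_range_succ, digit_add_mul_self ha hb, psiTrunc]
  congr 1
  refine Finset.prod_congr rfl fun j hj => ?_
  rw [digit_add_mul hm _ _ (Finset.mem_range.1 hj)]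

theorem sum_psiTrunc_mul_conj [∀ n, NeZero (m n)] (hm : ∀ n, 2 ≤ m n) (n : ℕ) (x y : G m) :
    ∑ k ∈ Finset.range (Mprod m n), psiTrunc m n k x * (starRingEnd ℂ) (psiTrunc m n k y)
      = if ∀ j < n, x j = y j then (Mprod m n : ℂ) else 0 := by
  classical
  induction n with
  | zero => simp [Mprod, psiTrunc]
  | succ n ih =>
    have h1 : ∑ k ∈ Finset.range (Mprod m (n + 1)),
          psiTrunc m (n + 1) k x * (starRingEnd ℂ) (psiTrunc m (n + 1) k y)
        = (∑ b ∈ Finset.range (m n),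
            (zeta m n ^ (x n).val * (starRingEnd ℂ) (zeta m n ^ (y n).val)) ^ b)
          * ∑ a ∈ Finset.range (Mprod m n),
            psiTrunc m n a x * (starRingEnd ℂ) (psiTrunc m n a y) := by
      rw [Mprod, sum_range_mul_eq, Finset.sum_mul_sum]
      refine Finset.sum_congr rfl fun b hb => Finset.sum_congr rfl fun a ha => ?_
      rw [psiTrunc_add_mul hm (Finset.mem_range.1 ha) (Finset.mem_range.1 hb),
        psiTrunc_add_mul hm (Finset.mem_range.1 ha) (Finset.mem_range.1 hb), rad_eq, rad_eq,
        mul_pow, map_mul, map_pow _ _ b]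
      ring
    rw [h1, ih, sum_zeta_pow hm n (ZMod.val_lt _) (ZMod.val_lt _)]
    have h2 : (∀ j < n + 1, x j = y j) ↔ (∀ j < n, x j = y j) ∧ (x n).val = (y n).val := by
      rw [(ZMod.val_injective (m n)).eq_iff]
      exact Nat.forall_lt_succ_right
    rw [if_congr h2 rfl rfl, ite_and, Mprod]
    split_ifs <;> simp

theorem psiTrunc_add_single [∀ n, NeZero (m n)] (hm : ∀ n, 2 ≤ m n) {n t : ℕ} (ht : t < n)
    (k s : ℕ) (x : G m) :
    psiTrunc m n k (x + Pi.single t (s : ZMod (m t)))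
      = psiTrunc m n k x * (zeta m t ^ s) ^ digit m k t := by
  have h : ∀ j, rad m j (x + Pi.single t (s : ZMod (m t)))
      = rad m j x * if j = t then zeta m t ^ s else 1 := by
    intro j
    rw [rad_eq, rad_eq]
    split_ifs with hj
    · subst hj
      rw [Pi.add_apply, Pi.single_eq_same, ZMod.val_add, ZMod.val_natCast, Nat.add_mod_mod,
        ← pow_add]
      exact (pow_eq_pow_mod _ (zeta_primitive hm j).pow_eq_one).symm
    · simp [Pi.single_eq_of_ne hj]
  simp only [psiTrunc, h, mul_pow, Finset.prod_mul_distrib, ite_pow, one_pow]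
  congr 1
  rw [Finset.prod_ite_eq' (Finset.range n) t fun j => (zeta m t ^ s) ^ digit m k j]
  simp [ht]

variable (m) in
/-- Restriction of a point of the Vilenkin group to its first `n` coordinates. -/
def restr (n : ℕ) (x : G m) : ∀ j : Fin n, ZMod (m j) := fun j => x j

theorem restr_eq_iff {n : ℕ} {x y : G m} : restr m n x = restr m n y ↔ ∀ j < n, x j = y j :=
  ⟨fun h j hj => congrFun h ⟨j, hj⟩, fun h => funext fun j => h j j.2⟩

theorem measurable_restr (n : ℕ) : Measurable (restr m n) :=
  measurable_pi_lambda _ fun j => measurable_pi_apply (j : ℕ)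

theorem preimage_restr (n : ℕ) (x : G m) : restr m n ⁻¹' {restr m n x} = cylinder m n x := by
  ext y
  exact restr_eq_iff

theorem restr_surjective (n : ℕ) : Function.Surjective (restr m n) := by
  intro y
  refine ⟨fun j => if h : j < n then y ⟨j, h⟩ else 0, ?_⟩
  ext j
  simp [restr]

theorem filtr_le (n : ℕ) : filtr m n ≤ MeasurableSpace.pi :=
  (measurable_restr n).comap_le

theorem measurableSet_filtr_preimage_restr (n : ℕ) (y : ∀ j : Fin n, ZMod (m j)) :
    MeasurableSet[filtr m n] (restr m n ⁻¹' {y}) :=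
  ⟨{y}, measurableSet_singleton y, rfl⟩

theorem measurableSet_cylinder (n : ℕ) (x : G m) : MeasurableSet (cylinder m n x) := by
  rw [← preimage_restr]
  exact measurable_restr n (measurableSet_singleton _)

theorem eq_of_restr_eq {n : ℕ} {g : G m → ℂ} (hg : Measurable[filtr m n] g) {x y : G m}
    (h : restr m n x = restr m n y) : g x = g y :=
  Measurable.factorsThrough (f := restr m n) hg h

theorem measurable_rad (k : ℕ) : Measurable (rad m k) :=
  (measurable_from_top (f := fun z : ZMod (m k) =>
    Complex.exp (2 * Real.pi * Complex.I * (z.val : ℂ) / (m k : ℂ)))).comp (measurable_pi_apply k)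

theorem norm_rad (hm : ∀ n, 2 ≤ m n) (k : ℕ) (x : G m) : ‖rad m k x‖ = 1 := by
  rw [rad_eq, norm_pow, norm_zeta hm, one_pow]

theorem measurable_psi (k : ℕ) : Measurable (psi m k) :=
  Finset.measurable_fun_prod _ fun j _ => (measurable_rad j).pow_const _

theorem norm_psi (hm : ∀ n, 2 ≤ m n) (k : ℕ) (x : G m) : ‖psi m k x‖ = 1 := by
  simp [psi, norm_rad hm]

theorem integrable_mul_conj_psi (hm : ∀ n, 2 ≤ m n) {μ : Measure (G m)} {g : G m → ℂ}
    (hg : Integrable g μ) (k : ℕ) :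
    Integrable (fun x => g x * (starRingEnd ℂ) (psi m k x)) μ := by
  refine hg.mul_bdd (c := 1) ?_ (Eventually.of_forall fun x => ?_)
  · exact (Complex.continuous_conj.measurable.comp (measurable_psi k)).aestronglyMeasurable
  · simp [norm_psi hm]

theorem psi_eq_of_restr_eq (hm : ∀ n, 2 ≤ m n) {n k : ℕ} (hk : k < Mprod m n) {x y : G m}
    (h : restr m n x = restr m n y) : psi m k x = psi m k y := by
  rw [psi_eq_psiTrunc hm hk, psi_eq_psiTrunc hm hk]
  refine Finset.prod_congr rfl fun j hj => ?_
  rw [rad_eq, rad_eq, restr_eq_iff.1 h j (Finset.mem_range.1 hj)]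

theorem integral_eq_sum_restr [∀ n, NeZero (m n)] {μ : Measure (G m)} {g : G m → ℂ}
    (hg : Integrable g μ) (n : ℕ) :
    ∫ x, g x ∂μ = ∑ y, ∫ x in restr m n ⁻¹' {y}, g x ∂μ := by
  classical
  rw [← integral_iUnion_fintype (fun y => measurable_restr n (measurableSet_singleton y)) ?_
    fun _ => hg.integrableOn, ← Set.preimage_iUnion, Set.iUnion_of_singleton, Set.preimage_univ,
    setIntegral_univ]
  intro y z hyz
  exact Disjoint.preimage _ (Set.disjoint_singleton.2 hyz)

theorem integral_succ_mul_conj_psi [∀ n, NeZero (m n)] (hm : ∀ n, 2 ≤ m n) {μ : Measure (G m)}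
    {f : ℕ → G m → ℂ} (hf : IsMartingale m μ f) {n k : ℕ} (hk : k < Mprod m n) :
    ∫ x, f (n + 1) x * (starRingEnd ℂ) (psi m k x) ∂μ
      = ∫ x, f n x * (starRingEnd ℂ) (psi m k x) ∂μ := by
  rw [integral_eq_sum_restr (integrable_mul_conj_psi hm (hf.1 (n + 1)) k) n,
    integral_eq_sum_restr (integrable_mul_conj_psi hm (hf.1 n) k) n]
  refine Finset.sum_congr rfl fun y _ => ?_
  obtain ⟨z, rfl⟩ := restr_surjective n y
  have hs := measurableSet_filtr_preimage_restr n (restr m n z)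
  have key : ∀ i, ∫ x in restr m n ⁻¹' {restr m n z}, f i x * (starRingEnd ℂ) (psi m k x) ∂μ
      = (∫ x in restr m n ⁻¹' {restr m n z}, f i x ∂μ) * (starRingEnd ℂ) (psi m k z) := by
    intro i
    rw [← integral_mul_const]
    refine setIntegral_congr_fun (filtr_le n _ hs) fun x hx => ?_
    simp only [psi_eq_of_restr_eq hm hk (show restr m n x = restr m n z from hx)]
  rw [key, key, hf.2.2 n _ hs]

theorem martCoeff_eq [∀ n, NeZero (m n)] (hm : ∀ n, 2 ≤ m n) {μ : Measure (G m)}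
    {f : ℕ → G m → ℂ} (hf : IsMartingale m μ f) {n k : ℕ} (hk : k < Mprod m n) :
    martCoeff m μ f k = ∫ x, f n x * (starRingEnd ℂ) (psi m k x) ∂μ := by
  refine (tendsto_const_nhds.congr' ?_).limUnder_eq
  filter_upwards [eventually_ge_atTop n] with N hN
  induction N, hN using Nat.le_induction with
  | base => rfl
  | succ N hN ih =>
    have : k < Mprod m N := hk.trans_le (Nat.le_of_dvd (Mprod_pos hm N) (Mprod_dvd hN))
    rw [integral_succ_mul_conj_psi hm hf this, ih]

/-- The martingale element `f^{(n)}` is the partial sum `S_{M_n} f`. -/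
theorem sum_martCoeff_mul_psi [∀ n, NeZero (m n)] (hm : ∀ n, 2 ≤ m n) {μ : Measure (G m)}
    (hμ : IsVilenkinMeasure m μ) {f : ℕ → G m → ℂ} (hf : IsMartingale m μ f) (n : ℕ) (x : G m) :
    ∑ k ∈ Finset.range (Mprod m n), martCoeff m μ f k * psi m k x = f n x := by
  classical
  calc ∑ k ∈ Finset.range (Mprod m n), martCoeff m μ f k * psi m k x
      = ∑ k ∈ Finset.range (Mprod m n),
          ∫ y, f n y * (starRingEnd ℂ) (psi m k y) * psi m k x ∂μ := by
        refine Finset.sum_congr rfl fun k hk => ?_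
        rw [martCoeff_eq hm hf (Finset.mem_range.1 hk), integral_mul_const]
    _ = ∫ y, ∑ k ∈ Finset.range (Mprod m n),
          f n y * (starRingEnd ℂ) (psi m k y) * psi m k x ∂μ :=
        (integral_finsetSum _ fun k _ =>
          (integrable_mul_conj_psi hm (hf.1 n) k).mul_const _).symm
    _ = ∫ y, (cylinder m n x).indicator (fun _ => f n x * (Mprod m n : ℂ)) y ∂μ := by
        congr 1
        ext y
        have h1 : ∑ k ∈ Finset.range (Mprod m n),
            f n y * (starRingEnd ℂ) (psi m k y) * psi m k x
            = f n y * if ∀ j < n, x j = y j then (Mprod m n : ℂ) else 0 := by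
          rw [← sum_psiTrunc_mul_conj hm, Finset.mul_sum]
          refine Finset.sum_congr rfl fun k hk => ?_
          rw [psi_eq_psiTrunc hm (Finset.mem_range.1 hk), psi_eq_psiTrunc hm (Finset.mem_range.1 hk)]
          ring
        rw [h1]
        by_cases h : ∀ j < n, x j = y j
        · rw [if_pos h, Set.indicator_of_mem (show y ∈ cylinder m n x from fun j hj => (h j hj).symm),
            eq_of_restr_eq (hf.2.1 n) (restr_eq_iff.2 h)]
        · rw [if_neg h, Set.indicator_of_notMem, mul_zero]
          exact fun hy => h fun j hj => (hy j hj).symm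
    _ = f n x := by
        have h0 : (Mprod m n : ℂ) ≠ 0 := Nat.cast_ne_zero.2 (Mprod_pos hm n).ne'
        rw [integral_indicator (measurableSet_cylinder n x), setIntegral_const, measureReal_def,
          hμ.2, Complex.real_smul]
        simp only [ENNReal.toReal_inv, ENNReal.toReal_natCast, Complex.ofReal_inv,
          Complex.ofReal_natCast]
        field_simp

theorem lintegral_comp_restr [∀ n, NeZero (m n)] {μ : Measure (G m)}
    (hμ : IsVilenkinMeasure m μ) (n : ℕ) (g : (∀ j : Fin n, ZMod (m j)) → ℝ≥0∞) :
    ∫⁻ x, g (restr m n x) ∂μ = ∑ y, g y * (Mprod m n : ℝ≥0∞)⁻¹ := by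
  rw [← lintegral_map (Measurable.of_discrete) (measurable_restr n), lintegral_fintype]
  refine Finset.sum_congr rfl fun y _ => ?_
  obtain ⟨z, rfl⟩ := restr_surjective n y
  rw [Measure.map_apply (measurable_restr n) (measurableSet_singleton _), preimage_restr, hμ.2]

/-- Translation invariance of integrals of `F_n`-measurable functions. -/
theorem lintegral_add_right [∀ n, NeZero (m n)] {μ : Measure (G m)}
    (hμ : IsVilenkinMeasure m μ) {n : ℕ} {g : G m → ℂ} (hg : Measurable[filtr m n] g) (p : ℝ)
    (u : G m) : ∫⁻ x, ‖g (x + u)‖ₑ ^ p ∂μ = ∫⁻ x, ‖g x‖ₑ ^ p ∂μ := by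
  obtain ⟨h, -, rfl⟩ := Measurable.exists_eq_measurable_comp (f := restr m n) hg
  have h1 := lintegral_comp_restr hμ n fun y => ‖h y‖ₑ ^ p
  have h2 := lintegral_comp_restr hμ n fun y => ‖h (y + restr m n u)‖ₑ ^ p
  refine h2.trans (Eq.trans ?_ h1.symm)
  exact Equiv.sum_comp (Equiv.addRight (restr m n u))
    fun y => ‖h y‖ₑ ^ p * (Mprod m n : ℝ≥0∞)⁻¹

variable (m) in
/-- The coefficients expressing the digit at position `t` as a combination of characters. -/
def digitCoeff (t s : ℕ) : ℂ :=
  (m t : ℂ)⁻¹ * ∑ b ∈ Finset.range (m t), (b : ℂ) * (starRingEnd ℂ) (zeta m t ^ b) ^ s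

theorem sum_digitCoeff (hm : ∀ n, 2 ≤ m n) (t : ℕ) {d : ℕ} (hd : d < m t) :
    ∑ s ∈ Finset.range (m t), digitCoeff m t s * (zeta m t ^ s) ^ d = d := by
  have h0 : (m t : ℂ) ≠ 0 := Nat.cast_ne_zero.2 (by omega)
  calc ∑ s ∈ Finset.range (m t), digitCoeff m t s * (zeta m t ^ s) ^ d
      = (m t : ℂ)⁻¹ * ∑ b ∈ Finset.range (m t), (b : ℂ) * ∑ s ∈ Finset.range (m t),
          (zeta m t ^ d * (starRingEnd ℂ) (zeta m t ^ b)) ^ s := by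
        simp only [digitCoeff, mul_assoc, ← Finset.mul_sum, Finset.sum_mul]
        rw [Finset.sum_comm]
        simp only [Finset.mul_sum]
        refine Finset.sum_congr rfl fun b _ => Finset.sum_congr rfl fun s _ => ?_
        rw [mul_pow, pow_right_comm]
        ring
    _ = (m t : ℂ)⁻¹ * ∑ b ∈ Finset.range (m t), (b : ℂ) * if d = b then (m t : ℂ) else 0 := by
        congr 1
        refine Finset.sum_congr rfl fun b hb => ?_
        rw [sum_zeta_pow hm t hd (Finset.mem_range.1 hb)]
    _ = d := by
        simp only [mul_ite, mul_zero, Finset.sum_ite_eq, Finset.mem_range, hd, if_true]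
        field_simp

theorem norm_digitCoeff_le (hm : ∀ n, 2 ≤ m n) (t s : ℕ) : ‖digitCoeff m t s‖ ≤ m t := by
  have h0 : (0 : ℝ) < m t := Nat.cast_pos.2 (by have := hm t; omega)
  rw [digitCoeff, norm_mul, norm_inv, Complex.norm_natCast, inv_mul_le_iff₀ h0]
  calc _ ≤ ∑ b ∈ Finset.range (m t), ‖(b : ℂ) * (starRingEnd ℂ) (zeta m t ^ b) ^ s‖ :=
        norm_sum_le _ _
    _ ≤ ∑ b ∈ Finset.range (m t), (m t : ℝ) := by
        refine Finset.sum_le_sum fun b hb => ?_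
        rw [norm_mul, norm_pow, RCLike.norm_conj, norm_pow, norm_zeta hm, one_pow, one_pow, mul_one,
          Complex.norm_natCast]
        exact_mod_cast (Finset.mem_range.1 hb).le
    _ = m t * m t := by simp

/-- The Fejér mean of order `M_n` is a combination of translates of `f^{(n)}`. -/
theorem sigmaMart_Mprod_eq [∀ n, NeZero (m n)] (hm : ∀ n, 2 ≤ m n) {μ : Measure (G m)}
    (hμ : IsVilenkinMeasure m μ) {f : ℕ → G m → ℂ} (hf : IsMartingale m μ f) (n : ℕ) (x : G m) :
    sigmaMart m μ f (Mprod m n) x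
      = (Mprod m n : ℂ)⁻¹ * ((Mprod m n : ℂ) - 1) * f n x
        + ∑ t ∈ Finset.range n, ∑ s ∈ Finset.range (m t),
          -((Mprod m n : ℂ)⁻¹ * (Mprod m t : ℂ) * digitCoeff m t s)
            * f n (x + Pi.single t (s : ZMod (m t))) := by
  have hshift : ∀ t ∈ Finset.range n, ∀ s : ℕ, f n (x + Pi.single t (s : ZMod (m t)))
      = ∑ k ∈ Finset.range (Mprod m n),
        martCoeff m μ f k * psi m k x * (zeta m t ^ s) ^ digit m k t := by
    intro t ht s
    rw [← sum_martCoeff_mul_psi hm hμ hf]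
    refine Finset.sum_congr rfl fun k hk => ?_
    rw [psi_eq_psiTrunc hm (Finset.mem_range.1 hk), psi_eq_psiTrunc hm (Finset.mem_range.1 hk),
      psiTrunc_add_single hm (Finset.mem_range.1 ht), mul_assoc]
  have hweighted : ∑ k ∈ Finset.range (Mprod m n), (k : ℂ) * (martCoeff m μ f k * psi m k x)
      = ∑ t ∈ Finset.range n, ∑ s ∈ Finset.range (m t),
        (Mprod m t : ℂ) * digitCoeff m t s * f n (x + Pi.single t (s : ZMod (m t))) := by
    calc ∑ k ∈ Finset.range (Mprod m n), (k : ℂ) * (martCoeff m μ f k * psi m k x)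
        = ∑ k ∈ Finset.range (Mprod m n), ∑ t ∈ Finset.range n, ∑ s ∈ Finset.range (m t),
            (Mprod m t : ℂ) * (digitCoeff m t s * (zeta m t ^ s) ^ digit m k t)
              * (martCoeff m μ f k * psi m k x) := by
          refine Finset.sum_congr rfl fun k hk => ?_
          have h1 := mod_Mprod_eq_sum (m := m) k n
          rw [Nat.mod_eq_of_lt (Finset.mem_range.1 hk)] at h1
          simp only [← Finset.sum_mul, ← Finset.mul_sum]
          congr 1
          conv_lhs => rw [h1]
          push_cast
          refine Finset.sum_congr rfl fun t _ => ?_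
          rw [sum_digitCoeff hm t (d := digit m k t) (Nat.mod_lt _ (by have := hm t; omega))]
      _ = _ := by
          rw [Finset.sum_comm]
          refine Finset.sum_congr rfl fun t ht => ?_
          rw [Finset.sum_comm]
          refine Finset.sum_congr rfl fun s _ => ?_
          rw [hshift t ht, Finset.mul_sum]
          refine Finset.sum_congr rfl fun k _ => ?_
          ring
  simp only [sigmaMart, SMart]
  rw [sum_sum_range, sum_martCoeff_mul_psi hm hμ hf, hweighted, mul_sub, ← mul_assoc,
    sub_eq_add_neg, Finset.mul_sum, ← Finset.sum_neg_distrib]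
  congr 1
  refine Finset.sum_congr rfl fun t _ => ?_
  rw [Finset.mul_sum, ← Finset.sum_neg_distrib]
  refine Finset.sum_congr rfl fun s _ => ?_
  ring

theorem rpow_sum_le {ι : Type*} (s : Finset ι) (a : ι → ℝ≥0∞) {p : ℝ} (hp0 : 0 < p)
    (hp1 : p ≤ 1) : (∑ i ∈ s, a i) ^ p ≤ ∑ i ∈ s, a i ^ p :=
  Finset.le_sum_of_subadditive (fun z : ℝ≥0∞ => z ^ p) (ENNReal.zero_rpow_of_pos hp0).le
    (fun a b => ENNReal.rpow_add_le_add_rpow a b hp0.le hp1) s a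

theorem sum_pow_sub_le (q : ℝ≥0∞) (hq : q ≤ 1) (n : ℕ) :
    ∑ t ∈ Finset.range n, q ^ (n - t) ≤ (1 - q)⁻¹ := by
  calc ∑ t ∈ Finset.range n, q ^ (n - t) ≤ ∑ t ∈ Finset.range n, q ^ (n - 1 - t) :=
        Finset.sum_le_sum fun t _ => pow_le_pow_right_of_le_one' hq (by omega)
    _ = ∑ t ∈ Finset.range n, q ^ t := Finset.sum_range_reflect (fun t => q ^ t) n
    _ ≤ ∑' t, q ^ t := ENNReal.sum_le_tsum _
    _ = (1 - q)⁻¹ := ENNReal.tsum_geometric q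

theorem enorm_sigmaMart_le [∀ n, NeZero (m n)] (hm : ∀ n, 2 ≤ m n) {B : ℕ} (hB : ∀ n, m n ≤ B)
    {μ : Measure (G m)} (hμ : IsVilenkinMeasure m μ) {f : ℕ → G m → ℂ}
    (hf : IsMartingale m μ f) (n : ℕ) (x : G m) :
    ‖sigmaMart m μ f (Mprod m n) x‖ₑ ≤ ‖f n x‖ₑ
      + ∑ t ∈ Finset.range n, ∑ s ∈ Finset.range (m t),
        ((B : ℝ≥0∞) * 2⁻¹ ^ (n - t)) * ‖f n (x + Pi.single t (s : ZMod (m t)))‖ₑ := by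
  have hM : (0 : ℝ) < Mprod m n := Nat.cast_pos.2 (Mprod_pos hm n)
  have hM1 : (1 : ℝ) ≤ Mprod m n := Nat.one_le_cast.2 (Mprod_pos hm n)
  rw [sigmaMart_Mprod_eq hm hμ hf]
  refine (enorm_add_le _ _).trans (add_le_add ?_ ?_)
  · rw [enorm_mul]
    refine mul_le_of_le_one_left' ?_
    rw [← ofReal_norm, ENNReal.ofReal_le_one, norm_mul, norm_inv, Complex.norm_natCast,
      inv_mul_le_iff₀ hM, mul_one]
    have : (Mprod m n : ℂ) - 1 = ((Mprod m n - 1 : ℝ) : ℂ) := by push_cast; rfl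
    rw [this, Complex.norm_real, Real.norm_of_nonneg (by linarith)]
    linarith
  · refine (enorm_sum_le _ _).trans (Finset.sum_le_sum fun t ht => ?_)
    refine (enorm_sum_le _ _).trans (Finset.sum_le_sum fun s _ => ?_)
    rw [enorm_mul]
    gcongr
    have hw : ((B : ℝ≥0∞) * 2⁻¹ ^ (n - t)) = ENNReal.ofReal ((B : ℝ) * 2⁻¹ ^ (n - t)) := by
      rw [ENNReal.ofReal_mul (by positivity), ENNReal.ofReal_pow (by positivity),
        ENNReal.ofReal_inv_of_pos (by norm_num)]
      simp
    rw [hw, ← ofReal_norm]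
    refine ENNReal.ofReal_le_ofReal ?_
    rw [norm_neg, norm_mul, norm_mul, norm_inv, Complex.norm_natCast, Complex.norm_natCast, mul_comm]
    have hc : ‖digitCoeff m t s‖ ≤ B :=
      (norm_digitCoeff_le hm t s).trans (Nat.cast_le.2 (hB t))
    gcongr
    rw [inv_mul_le_iff₀ hM, inv_pow, ← div_eq_mul_inv, le_div_iff₀ (by positivity), mul_comm]
    have h1 := two_pow_mul_Mprod_le hm t (n - t)
    rw [Nat.add_sub_of_le (Finset.mem_range.1 ht).le] at h1
    exact_mod_cast h1

theorem lintegral_sigmaMart_le [∀ n, NeZero (m n)] (hm : ∀ n, 2 ≤ m n) {B : ℕ}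
    (hB : ∀ n, m n ≤ B) {μ : Measure (G m)} (hμ : IsVilenkinMeasure m μ) {f : ℕ → G m → ℂ}
    (hf : IsMartingale m μ f) {p : ℝ} (hp0 : 0 < p) (hp1 : p ≤ 1) (n : ℕ) :
    ∫⁻ x, ‖sigmaMart m μ f (Mprod m n) x‖ₑ ^ p ∂μ
      ≤ (1 + B * (B ^ p * (1 - 2⁻¹ ^ p)⁻¹)) * ∫⁻ x, ‖f n x‖ₑ ^ p ∂μ := by
  have hfm : Measurable (f n) := (hf.2.1 n).mono (filtr_le n) le_rfl
  have hshift : ∀ u : G m, Measurable fun x => ‖f n (x + u)‖ₑ ^ p := fun u => by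
    have : Measurable fun x : G m => x + u := measurable_pi_lambda _ fun j =>
      (measurable_from_top (f := fun z : ZMod (m j) => z + u j)).comp (measurable_pi_apply j)
    exact (hfm.comp this).enorm.pow_const p
  set J := ∫⁻ x, ‖f n x‖ₑ ^ p ∂μ with hJ
  set q : ℝ≥0∞ := 2⁻¹ ^ p with hq
  have hq1 : q ≤ 1 := ENNReal.rpow_le_one (by simp) hp0.le
  calc ∫⁻ x, ‖sigmaMart m μ f (Mprod m n) x‖ₑ ^ p ∂μ
      ≤ ∫⁻ x, (‖f n x‖ₑ ^ p + ∑ t ∈ Finset.range n, ∑ s ∈ Finset.range (m t),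
          ((B : ℝ≥0∞) ^ p * q ^ (n - t))
            * ‖f n (x + Pi.single t (s : ZMod (m t)))‖ₑ ^ p) ∂μ := by
        refine lintegral_mono fun x => ?_
        refine (ENNReal.rpow_le_rpow (enorm_sigmaMart_le hm hB hμ hf n x) hp0.le).trans ?_
        refine (ENNReal.rpow_add_le_add_rpow _ _ hp0.le hp1).trans ?_
        gcongr
        refine (rpow_sum_le _ _ hp0 hp1).trans (Finset.sum_le_sum fun t _ => ?_)
        refine (rpow_sum_le _ _ hp0 hp1).trans (Finset.sum_le_sum fun s _ => le_of_eq ?_)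
        rw [ENNReal.mul_rpow_of_nonneg _ _ hp0.le, ENNReal.mul_rpow_of_nonneg _ _ hp0.le, hq,
          ← ENNReal.rpow_natCast, ← ENNReal.rpow_mul, mul_comm _ p, ENNReal.rpow_mul,
          ENNReal.rpow_natCast]
    _ = J + ∑ t ∈ Finset.range n, ∑ s ∈ Finset.range (m t),
          ((B : ℝ≥0∞) ^ p * q ^ (n - t)) * J := by
        rw [lintegral_add_left (hfm.enorm.pow_const p), lintegral_finsetSum _ fun t _ =>
          Finset.measurable_fun_sum _ fun s _ => (hshift _).const_mul _]
        congr 1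
        refine Finset.sum_congr rfl fun t _ => ?_
        rw [lintegral_finsetSum _ fun s _ => (hshift _).const_mul _]
        refine Finset.sum_congr rfl fun s _ => ?_
        rw [lintegral_const_mul _ (hshift _), lintegral_add_right hμ (hf.2.1 n)]
    _ ≤ J + ∑ t ∈ Finset.range n, (B : ℝ≥0∞) * (((B : ℝ≥0∞) ^ p * q ^ (n - t)) * J) := by
        gcongr with t _
        rw [Finset.sum_const, Finset.card_range, nsmul_eq_mul]
        gcongr
        exact hB t
    _ = (1 + B * (B ^ p * ∑ t ∈ Finset.range n, q ^ (n - t))) * J := by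
        simp only [add_mul, one_mul, Finset.mul_sum, Finset.sum_mul, mul_assoc]
    _ ≤ (1 + B * (B ^ p * (1 - q)⁻¹)) * J := by
        gcongr
        exact sum_pow_sub_le q hq1 n

end Auxiliary

/-- Corollary 2 (Weisz): for `0 < p < 1/2` the means `σ_{M_n}` are uniformly bounded
from `H_p` to `L_p`. -/
theorem fejer_Mn_bound
    (m : ℕ → ℕ) (hm : ∀ n, 2 ≤ m n) (hbdd : ∃ B, ∀ n, m n ≤ B)
    (μ : Measure (G m)) (hμ : IsVilenkinMeasure m μ)
    (p : ℝ) (hp0 : 0 < p) (hp : p < 1 / 2) :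
    ∃ c : ℝ≥0, 0 < c ∧
      ∀ f : ℕ → G m → ℂ, IsMartingale m μ f → hardyNorm m p μ f < ⊤ →
        ∀ n : ℕ,
          eLpNorm (sigmaMart m μ f (Mprod m n)) (ENNReal.ofReal p) μ ≤
            (c : ℝ≥0∞) * hardyNorm m p μ f := by

  obtain ⟨B, hB⟩ := hbdd
  have : ∀ n, NeZero (m n) := fun n => ⟨by have := hm n; omega⟩
  have hp1 : p ≤ 1 := by linarith
  set C : ℝ≥0∞ := 1 + B * (B ^ p * (1 - 2⁻¹ ^ p)⁻¹) with hC
  have hCtop : C ≠ ⊤ := by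
    have hq : (2⁻¹ : ℝ≥0∞) ^ p < 1 := ENNReal.rpow_lt_one (by simp) hp0
    have h1 : (1 - (2⁻¹ : ℝ≥0∞) ^ p)⁻¹ ≠ ⊤ := ENNReal.inv_ne_top.2 (tsub_pos_of_lt hq).ne'
    have h2 : (B : ℝ≥0∞) ^ p ≠ ⊤ := ENNReal.rpow_ne_top_of_nonneg hp0.le (ENNReal.natCast_ne_top B)
    exact ENNReal.add_ne_top.2 ⟨ENNReal.one_ne_top,
      ENNReal.mul_ne_top (ENNReal.natCast_ne_top B) (ENNReal.mul_ne_top h2 h1)⟩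
  have hCpos : 0 < C := lt_of_lt_of_le one_pos le_self_add
  have hCp : C ^ (1 / p) ≠ ⊤ := ENNReal.rpow_ne_top_of_nonneg (by positivity) hCtop
  refine ⟨(C ^ (1 / p)).toNNReal, ENNReal.toNNReal_pos (ENNReal.rpow_pos hCpos hCtop).ne' hCp,
    fun f hf _ n => ?_⟩
  rw [ENNReal.coe_toNNReal hCp, hardyNorm, ← ENNReal.mul_rpow_of_nonneg _ _ (by positivity),
    eLpNorm_eq_lintegral_rpow_enorm_toReal (by simpa using hp0) ENNReal.ofReal_ne_top,
    ENNReal.toReal_ofReal hp0.le]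
  refine ENNReal.rpow_le_rpow ((lintegral_sigmaMart_le hm hB hμ hf hp0 hp1 n).trans ?_)
    (by positivity)
  gcongr with x
  exact le_iSup (fun n => (‖f n x‖₊ : ℝ≥0∞)) n

end Vilenkin
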